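/- Let σ > 0 and define, for 0 ≤ β < 1 and γ > 0, λ₋(β, γ) := γ² + (1 − β²)(1 + 1/(2σ)) − √((1 − β²)²(1 − 1/(2σ))² + 4β²(γ² + (1 − β²)/σ)) and λ₊(β, γ) := γ² + (1 − β²)(1 + 1/(2σ)) + √((1 − β²)²(1 − 1/(2σ))² + 4β²(γ² + (1 − β²)/σ)). Then: (i) if 0 ≤ β ≤ 1/√3, then λ₋(β, γ) > 0 and λ₊(β, γ) > 0 for every γ > 0; and (ii) if 1/√3 < β < 1, then there exists γ₀ > 0 such that λ₋(β, γ) < 0 for all 0 < γ < γ₀. -/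

import Mathlib

/-- The eigenvalue `λ₋(β, γ)` of the linearized operator. -/
noncomputable def lamMinus (σ β γ : ℝ) : ℝ :=
  γ ^ 2 + (1 - β ^ 2) * (1 + 1 / (2 * σ)) -
    Real.sqrt ((1 - β ^ 2) ^ 2 * (1 - 1 / (2 * σ)) ^ 2 +
      4 * β ^ 2 * (γ ^ 2 + (1 - β ^ 2) / σ))

/-- The eigenvalue `λ₊(β, γ)` of the linearized operator. -/
noncomputable def lamPlus (σ β γ : ℝ) : ℝ :=
  γ ^ 2 + (1 - β ^ 2) * (1 + 1 / (2 * σ)) +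
    Real.sqrt ((1 - β ^ 2) ^ 2 * (1 - 1 / (2 * σ)) ^ 2 +
      4 * β ^ 2 * (γ ^ 2 + (1 - β ^ 2) / σ))

/-- The product of the two eigenvalues factors as `(γ² + (1 - β²) / σ) (γ² + 2 (1 - 3β²))`. -/
theorem sq_sub_discriminant_eq (σ β γ : ℝ) :
    (γ ^ 2 + (1 - β ^ 2) * (1 + 1 / (2 * σ))) ^ 2 -
      ((1 - β ^ 2) ^ 2 * (1 - 1 / (2 * σ)) ^ 2 + 4 * β ^ 2 * (γ ^ 2 + (1 - β ^ 2) / σ)) =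
    (γ ^ 2 + (1 - β ^ 2) / σ) * (γ ^ 2 + 2 * (1 - 3 * β ^ 2)) := by
  ring

theorem half_trace_pos {σ β γ : ℝ} (hσ : 0 < σ) (hβ : β ^ 2 < 1) :
    0 < γ ^ 2 + (1 - β ^ 2) * (1 + 1 / (2 * σ)) := by
  have : 0 < 1 - β ^ 2 := sub_pos.2 hβ
  positivity

theorem lamPlus_pos {σ β γ : ℝ} (hσ : 0 < σ) (hβ : β ^ 2 < 1) : 0 < lamPlus σ β γ :=
  add_pos_of_pos_of_nonneg (half_trace_pos hσ hβ) (Real.sqrt_nonneg _)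

theorem lamMinus_pos_iff {σ β γ : ℝ} (hσ : 0 < σ) (hβ : β ^ 2 < 1) :
    0 < lamMinus σ β γ ↔ 0 < γ ^ 2 + 2 * (1 - 3 * β ^ 2) := by
  have hb : 0 < 1 - β ^ 2 := sub_pos.2 hβ
  have hc : 0 < γ ^ 2 + (1 - β ^ 2) / σ := by positivity
  rw [lamMinus, sub_pos, Real.sqrt_lt' (half_trace_pos hσ hβ), ← sub_pos,
    sq_sub_discriminant_eq, mul_pos_iff_of_pos_left hc]

theorem lamMinus_neg_iff {σ β γ : ℝ} (hσ : 0 < σ) (hβ : β ^ 2 < 1) :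
    lamMinus σ β γ < 0 ↔ γ ^ 2 + 2 * (1 - 3 * β ^ 2) < 0 := by
  have hb : 0 < 1 - β ^ 2 := sub_pos.2 hβ
  have hc : 0 < γ ^ 2 + (1 - β ^ 2) / σ := by positivity
  rw [lamMinus, sub_neg, Real.lt_sqrt (half_trace_pos hσ hβ).le, ← sub_neg,
    sq_sub_discriminant_eq, ← smul_eq_mul, smul_neg_iff_of_pos_left hc]

/-- Stability dichotomy: (i) for `0 ≤ β ≤ 1/√3` both eigenvalues are positive at
every wavenumber `γ > 0`; (ii) for `1/√3 < β < 1` there is `γ₀ > 0` with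
`λ₋(β, γ) < 0` for all `0 < γ < γ₀`. -/
theorem stability_dichotomy (σ : ℝ) (hσ : 0 < σ) :
    (∀ β : ℝ, 0 ≤ β → β ≤ 1 / Real.sqrt 3 →
      ∀ γ : ℝ, 0 < γ → 0 < lamMinus σ β γ ∧ 0 < lamPlus σ β γ) ∧
    (∀ β : ℝ, 1 / Real.sqrt 3 < β → β < 1 →
      ∃ γ₀ > (0 : ℝ), ∀ γ : ℝ, 0 < γ → γ < γ₀ → lamMinus σ β γ < 0) := by
  have h3 : (1 / Real.sqrt 3) ^ 2 = 1 / 3 := by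
    rw [div_pow, Real.sq_sqrt (by norm_num), one_pow]
  have h0 : 0 ≤ 1 / Real.sqrt 3 := by positivity
  refine ⟨fun β hβ0 hβ γ hγ => ?_, fun β hβ hβ1 => ?_⟩
  · have hsq : β ^ 2 ≤ 1 / 3 := h3 ▸ pow_le_pow_left₀ hβ0 hβ 2
    have hlt : β ^ 2 < 1 := by linarith
    refine ⟨(lamMinus_pos_iff hσ hlt).2 ?_, lamPlus_pos hσ hlt⟩
    linarith [pow_pos hγ 2]
  · have hsq : 1 / 3 < β ^ 2 := h3 ▸ pow_lt_pow_left₀ hβ h0 two_ne_zero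
    have hlt : β ^ 2 < 1 := pow_lt_one₀ (h0.trans hβ.le) hβ1 two_ne_zero
    refine ⟨Real.sqrt (2 * (3 * β ^ 2 - 1)), Real.sqrt_pos.2 (by linarith), fun γ hγ hγ₀ => ?_⟩
    rw [lamMinus_neg_iff hσ hlt]
    linarith [(Real.lt_sqrt hγ.le).1 hγ₀]
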